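/- Let n ≥ 2. Let T be the set of triples (u, w, x) where u, w ≥ 0 are integers and x ≠ 0 is a minimal vector of B_v^{u,w} with v = Σ(x), and let T₁ ⊆ T be the subset of triples additionally satisfying k_x < w (strict shape 1). There exists a function Φ : T → T₁ such that for every (u, w, x) ∈ T, writing (u', w', y) = Φ(u, w, x), one has |η_{u',Σ(y),w'}(y)| = |η_{u,Σ(x),w}(x)| + 3, and such that every element of T₁ has at most 20 preimages under Φ. -/

import Mathlib

def sigmaD (n : ℕ) (x : ℕ →₀ ℤ) : ℤ := x.sum fun i c => c * (n : ℤ) ^ i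

def l1D (x : ℕ →₀ ℤ) : ℕ := x.sum fun _ c => c.natAbs

def kIdx (x : ℕ →₀ ℤ) : ℕ := x.support.sup id

noncomputable def wVec (n i : ℕ) : ℕ →₀ ℤ := Finsupp.single i (-(n : ℤ)) + Finsupp.single (i + 1) 1

def etaLen (u w : ℕ) (x : ℕ →₀ ℤ) : ℕ :=
  if kIdx x ≤ w ∨ u ≤ w then
    u + l1D x + kIdx x + ((w : ℤ) - kIdx x).natAbs
  else
    ((kIdx x : ℤ) - u).natAbs + l1D x + kIdx x + w

def BoxSet (n u w : ℕ) (v : ℤ) : Set (ℕ →₀ ℤ) :=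
  {x | sigmaD n x = v ∧
    (∀ i < kIdx x, |x i| ≤ ((n / 2 : ℕ) : ℤ)) ∧
    (kIdx x < max u w → |x (kIdx x)| ≤ ((n / 2 : ℕ) : ℤ)) ∧
    (max u w ≤ kIdx x → |x (kIdx x)| ≤ ((n / 2 : ℕ) : ℤ) + if n = 2 then 2 else 1)}

def absLexLE (x y : ℕ →₀ ℤ) : Prop :=
  (∀ i, |x i| = |y i|) ∨ ∃ i : ℕ, (∀ j < i, |x j| = |y j|) ∧ |x i| < |y i|

def IsMinimalVec (n u w : ℕ) (x : ℕ →₀ ℤ) : Prop :=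
  (∀ y : ℕ →₀ ℤ, sigmaD n y = sigmaD n x → etaLen u w x ≤ etaLen u w y) ∧
  (Even n → ∀ y : ℕ →₀ ℤ, sigmaD n y = sigmaD n x → etaLen u w y = etaLen u w x → absLexLE x y)

/-- Triples `(u, w, x)` where `x ≠ 0` is a minimal vector of `B_v^{u,w}` with `v = Σ(x)`. -/
def Tset (n : ℕ) : Set (ℕ × ℕ × (ℕ →₀ ℤ)) :=
  {p | p.2.2 ≠ 0 ∧ p.2.2 ∈ BoxSet n p.1 p.2.1 (sigmaD n p.2.2) ∧
    IsMinimalVec n p.1 p.2.1 p.2.2}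

/-- The subset of triples of strict shape 1, i.e. with `k_x < w`. -/
def T1set (n : ℕ) : Set (ℕ × ℕ × (ℕ →₀ ℤ)) :=
  {p | p ∈ Tset n ∧ kIdx p.2.2 < p.2.1}


lemma core_key (m X c c' : ℤ) (hm : 2 ≤ m) (h1 : -(m - 1) ≤ X) (h2 : X ≤ m - 1) :
    |X + max (-1) (min 1 c) - m * max (-1) (min 1 c')| + |max (-1) (min 1 c)| + |c'|
      - |max (-1) (min 1 c')| ≤ |X + c - m * c'| + |c| := by
  have a1 : |max (-1) (min 1 c)| - max (-1) (min 1 c) ≤ |c| - c := by grind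
  have a2 : |max (-1) (min 1 c)| + max (-1) (min 1 c) ≤ |c| + c := by grind
  have a3 : -1 ≤ max (-1) (min 1 c) := by omega
  have a4 : max (-1) (min 1 c) ≤ 1 := by omega
  have a5 : |max (-1) (min 1 c)| + |c - max (-1) (min 1 c)| ≤ |c| := by grind
  generalize max (-1) (min 1 c) = d at *
  rcases lt_trichotomy c' 0 with h | h | h
  · have e : max (-1) (min 1 c') = -1 := by omega
    rw [e, abs_of_neg h, abs_of_nonneg (by linarith : 0 ≤ X + d - m * -1)]
    have : 0 ≤ (m - 1) * (-1 - c') := mul_nonneg (by omega) (by omega)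
    have := le_abs_self (X + c - m * c')
    have : |(-1:ℤ)| = 1 := by norm_num
    nlinarith
  · subst h
    have e : max (-1) (min 1 0) = (0:ℤ) := by norm_num
    rw [e]
    simp only [mul_zero, sub_zero]
    have := abs_add_le (X + c) (-(c - d))
    rw [abs_neg, show X + c + -(c - d) = X + d by ring] at this
    simp only [abs_zero]
    linarith
  · have e : max (-1) (min 1 c') = 1 := by omega
    rw [e, abs_of_pos h, abs_of_nonpos (by linarith : X + d - m * 1 ≤ 0)]
    have : 0 ≤ (m - 1) * (c' - 1) := mul_nonneg (by omega) (by omega)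
    have := neg_abs_le (X + c - m * c')
    have : |(1:ℤ)| = 1 := by norm_num
    nlinarith

open Finset in
lemma core (n : ℕ) (hn : 2 ≤ n) : ∀ (K N : ℕ) (X z : ℕ → ℤ) (c : ℤ), K + 1 ≤ N →
    (∀ i, |X i| ≤ n - 1) → (∀ i, K ≤ i → X i = 0) →
    ∑ i ∈ range N, z i * (n:ℤ) ^ i = ∑ i ∈ range N, X i * (n:ℤ) ^ i + c →
    ∃ t : ℕ → ℤ, (∀ i, K < i → t i = 0) ∧
      ∑ i ∈ range N, t i * (n:ℤ) ^ i = ∑ i ∈ range N, X i * (n:ℤ) ^ i + max (-1) (min 1 c) ∧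
      ∑ i ∈ range N, |t i| + |max (-1) (min 1 c)| ≤ ∑ i ∈ range N, |z i| + |c| ∧
      ((∃ i, K < i ∧ i < N ∧ z i ≠ 0) →
        ∑ i ∈ range N, |t i| + |max (-1) (min 1 c)| < ∑ i ∈ range N, |z i| + |c|) := by
  intro K
  induction K with
  | zero =>
    intro N X z c hN hX hX0 hs
    obtain ⟨N, rfl⟩ : ∃ M, N = M + 1 := ⟨N - 1, by omega⟩
    have hXz : ∀ i, X i = 0 := fun i => hX0 i (by omega)
    set cc := max (-1) (min 1 c) with hcc
    have hz0 : 0 ≤ ∑ i ∈ range N, |z (i+1)| := sum_nonneg (fun _ _ => abs_nonneg _)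
    have hfac : ∑ i ∈ range N, z (i+1) * (n:ℤ) ^ (i+1) = n * ∑ i ∈ range N, z (i+1) * (n:ℤ) ^ i := by
      rw [mul_sum]; refine sum_congr rfl fun i _ => by ring
    rw [sum_range_succ', hfac] at hs
    simp only [hXz, zero_mul, sum_const_zero, pow_zero, mul_one, zero_add] at hs
    have hpos : (∃ i, 0 < i ∧ i < N + 1 ∧ z i ≠ 0) → 1 ≤ ∑ i ∈ range N, |z (i+1)| := by
      rintro ⟨i, h0, h1, h2⟩
      obtain ⟨j, rfl⟩ : ∃ M, i = M + 1 := ⟨i - 1, by omega⟩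
      have := single_le_sum (f := fun i => |z (i+1)|) (fun _ _ => abs_nonneg _) (mem_range.2 (by omega : j < N))
      have h3 : 1 ≤ |z (j+1)| := Int.one_le_abs h2

      omega
    have hzz : (∑ i ∈ range N, |z (i+1)| = 0) → ∑ i ∈ range N, z (i+1) * (n:ℤ) ^ i = 0 := by
      intro h
      rw [sum_eq_zero_iff_of_nonneg (fun _ _ => abs_nonneg _)] at h
      refine sum_eq_zero fun i hi => ?_
      have := h i hi
      rw [abs_eq_zero] at this
      rw [this]; simp
    have hne : |c| = 1 → z 0 ≠ 0 := by
      intro h1 h2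
      rw [h2, add_zero] at hs
      have hd : (n:ℤ) ∣ c := ⟨_, hs.symm⟩
      have : (n:ℤ) ∣ 1 := by rw [← h1]; exact (dvd_abs _ _).2 hd
      have := Int.le_of_dvd (by norm_num) this
      omega
    refine ⟨fun i => if i = 0 then cc else 0, ?_, ?_, ?_, ?_⟩
    · intro i hi; simp; omega
    · rw [sum_range_succ']; simp [hXz]
    · rw [sum_range_succ', sum_range_succ']
      simp only [Nat.add_eq_zero_iff, one_ne_zero, and_false, if_false, if_true, abs_zero, sum_const_zero]
      rcases eq_or_lt_of_le hz0 with h | h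
      · have := hzz h.symm
        rw [this] at hs
        grind
      · by_cases h1 : |c| = 1
        · have := Int.one_le_abs (hne h1)
          grind
        · grind
    · intro hex
      have := hpos hex
      rw [sum_range_succ', sum_range_succ']
      simp only [Nat.add_eq_zero_iff, one_ne_zero, and_false, if_false, if_true, abs_zero, sum_const_zero]
      by_cases h1 : |c| = 1
      · have := Int.one_le_abs (hne h1)
        grind
      · grind
  | succ K ih =>
    intro N X z c hN hX hX0 hs
    obtain ⟨N, rfl⟩ : ∃ M, N = M + 1 := ⟨N - 1, by omega⟩
    have hfac : ∀ z : ℕ → ℤ, ∑ i ∈ range N, z (i+1) * (n:ℤ) ^ (i+1) = n * ∑ i ∈ range N, z (i+1) * (n:ℤ) ^ i := by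
      intro z
      rw [mul_sum]; refine sum_congr rfl fun i _ => by ring
    rw [sum_range_succ', sum_range_succ', hfac, hfac] at hs
    simp only [pow_zero, mul_one] at hs
    obtain ⟨c', hc'⟩ : ∃ c', c' = ∑ i ∈ range N, z (i+1) * (n:ℤ) ^ i - ∑ i ∈ range N, X (i+1) * (n:ℤ) ^ i := ⟨_, rfl⟩
    obtain ⟨t', h1, h2, h3, h4⟩ := ih N (fun i => X (i+1)) (fun i => z (i+1)) c' (by omega)
      (fun i => hX _) (fun i hi => hX0 _ (by omega)) (by omega)

    have hz0 : z 0 = X 0 + c - n * c' := by rw [hc']; linarith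
    have hx0 := abs_le.1 (hX 0)
    have key := core_key n (X 0) c c' (by exact_mod_cast hn) hx0.1 hx0.2
    rw [← hz0] at key
    obtain ⟨t, ht0, hts⟩ : ∃ t : ℕ → ℤ,
        t 0 = X 0 + max (-1) (min 1 c) - n * max (-1) (min 1 c') ∧ ∀ i, t (i+1) = t' i :=
      ⟨fun i => Nat.casesOn i (X 0 + max (-1) (min 1 c) - n * max (-1) (min 1 c')) t', rfl, fun _ => rfl⟩
    refine ⟨t, ?_, ?_, ?_, ?_⟩
    · intro i hi
      obtain ⟨j, rfl⟩ : ∃ M, i = M + 1 := ⟨i - 1, by omega⟩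
      rw [hts]
      exact h1 j (by omega)
    · rw [sum_range_succ', sum_range_succ', hfac X, hfac t]
      simp only [pow_zero, mul_one, hts, ht0]
      rw [h2]; ring
    · rw [sum_range_succ', sum_range_succ']
      simp only [hts, ht0]
      linarith
    · rintro ⟨i, ha, hb, hc⟩
      obtain ⟨j, rfl⟩ : ∃ M, i = M + 1 := ⟨i - 1, by omega⟩
      have := h4 ⟨j, by omega, by omega, hc⟩
      rw [sum_range_succ', sum_range_succ']
      simp only [hts, ht0]
      linarith

lemma kIdx_le (x : ℕ →₀ ℤ) (K : ℕ) : kIdx x ≤ K ↔ ∀ i, K < i → x i = 0 := by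
  unfold kIdx
  rw [Finset.sup_le_iff]
  constructor
  · intro h i hi
    by_contra h0
    have := h i (Finsupp.mem_support_iff.2 h0)
    simp at this; omega
  · intro h i hi
    by_contra h0
    simp at h0
    exact (Finsupp.mem_support_iff.1 hi) (h i h0)

lemma above_kIdx (x : ℕ →₀ ℤ) (i : ℕ) (h : kIdx x < i) : x i = 0 :=
  (kIdx_le x _).1 le_rfl i h

lemma supp_sub (x : ℕ →₀ ℤ) (N : ℕ) (h : kIdx x < N) : x.support ⊆ Finset.range N := by
  intro i hi
  by_contra h0
  simp at h0
  exact (Finsupp.mem_support_iff.1 hi) (above_kIdx x i (by omega))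

lemma sigma_range (n : ℕ) (x : ℕ →₀ ℤ) (N : ℕ) (h : kIdx x < N) :
    sigmaD n x = ∑ i ∈ Finset.range N, x i * (n:ℤ) ^ i := by
  unfold sigmaD
  exact Finsupp.sum_of_support_subset _ (supp_sub x N h) _ (by simp)

lemma l1_range (x : ℕ →₀ ℤ) (N : ℕ) (h : kIdx x < N) :
    (l1D x : ℤ) = ∑ i ∈ Finset.range N, |x i| := by
  unfold l1D
  rw [Finsupp.sum_of_support_subset _ (supp_sub x N h) _ (by simp)]
  push_cast
  rfl

lemma etaLen_eq (u w : ℕ) (x : ℕ →₀ ℤ) :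
    etaLen u w x = u + w + l1D x + 2 * (kIdx x - max u w) := by
  unfold etaLen
  split_ifs <;> omega

lemma clip (n : ℕ) (hn : 2 ≤ n) (X z : ℕ →₀ ℤ) (K : ℕ) (hX : ∀ i, |X i| ≤ n - 1)
    (hK : kIdx X ≤ K) (hs : sigmaD n z = sigmaD n X) :
    ∃ t : ℕ →₀ ℤ, kIdx t ≤ K + 1 ∧ sigmaD n t = sigmaD n X ∧ l1D t ≤ l1D z ∧
      (K + 1 < kIdx z → l1D t < l1D z) := by
  set N := max (K + 2) (kIdx z + 1) with hN
  have hs' := hs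
  rw [sigma_range n z N (by omega), sigma_range n X N (by omega)] at hs'
  obtain ⟨t, h1, h2, h3, h4⟩ := core n hn (K + 1) N X z 0 (by omega) hX
    (fun i hi => above_kIdx X i (by omega)) (by rw [hs']; simp)
  have hc : max (-1 : ℤ) (min 1 0) = 0 := by norm_num
  rw [hc] at h2 h3 h4
  simp only [abs_zero, add_zero] at h2 h3 h4
  have hf : ∀ i, t i ≠ 0 → i ∈ Finset.range N := by
    intro i hi
    by_contra h0
    simp only [Finset.mem_range, not_lt] at h0
    exact hi (h1 i (by omega))
  set T : ℕ →₀ ℤ := Finsupp.onFinset (Finset.range N) t hf with hT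
  have hTi : ∀ i, T i = t i := fun i => rfl
  have hk : kIdx T ≤ K + 1 := (kIdx_le _ _).2 fun i hi => h1 i hi
  refine ⟨T, hk, ?_, ?_, ?_⟩
  · rw [sigma_range n T N (by omega), sigma_range n X N (by omega)]
    exact h2
  · have a := l1_range T N (by omega)
    have b := l1_range z N (by omega)
    simp only [hTi] at a
    omega
  · intro h
    have a := l1_range T N (by omega)
    have b := l1_range z N (by omega)
    simp only [hTi] at a
    have := h4 ⟨kIdx z, h, by omega, fun h0 => by
      have : kIdx z ≤ kIdx z - 1 := (kIdx_le _ _).2 fun i hi => by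
        rcases eq_or_lt_of_le (show kIdx z ≤ i by omega) with e | e
        · rw [← e]; exact h0
        · exact above_kIdx z i e
      omega⟩
    omega

lemma sigma_add (n : ℕ) (x y : ℕ →₀ ℤ) : sigmaD n (x + y) = sigmaD n x + sigmaD n y := by
  unfold sigmaD
  exact Finsupp.sum_add_index' (by simp) (by intros; ring)

lemma sigma_sub (n : ℕ) (x y : ℕ →₀ ℤ) : sigmaD n (x - y) = sigmaD n x - sigmaD n y := by
  have := sigma_add n (x - y) y
  rw [sub_add_cancel] at this
  omega

lemma sigma_single (n i : ℕ) (a : ℤ) : sigmaD n (Finsupp.single i a) = a * (n:ℤ) ^ i := by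
  unfold sigmaD
  exact Finsupp.sum_single_index (by simp)

lemma l1_add_single (x : ℕ →₀ ℤ) (i : ℕ) (a : ℤ) :
    (l1D (x + Finsupp.single i a) : ℤ) + |x i| = l1D x + |x i + a| := by
  have h1 : kIdx (x + Finsupp.single i a) ≤ max i (kIdx x) := (kIdx_le _ _).2 fun j hj => by
    rw [Finsupp.add_apply, above_kIdx x j (by omega), Finsupp.single_apply, if_neg (by omega)]; rfl
  have hi : i ∈ Finset.range (max i (kIdx x) + 1) := Finset.mem_range.2 (by omega)
  rw [l1_range _ (max i (kIdx x) + 1) (by omega), l1_range x (max i (kIdx x) + 1) (by omega),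
    ← Finset.add_sum_erase _ _ hi, ← Finset.add_sum_erase _ (fun i => |x i|) hi]
  have : ∑ j ∈ (Finset.range (max i (kIdx x) + 1)).erase i, |(x + Finsupp.single i a) j| =
      ∑ j ∈ (Finset.range (max i (kIdx x) + 1)).erase i, |x j| := by
    refine Finset.sum_congr rfl fun j hj => ?_
    have := Finset.ne_of_mem_erase hj
    rw [Finsupp.add_apply, Finsupp.single_apply, if_neg (by omega), add_zero]
  rw [this]
  simp
  ring

/-- add `s` times the carry vector at `i` -/
noncomputable def carry (n : ℕ) (x : ℕ →₀ ℤ) (i : ℕ) (s : ℤ) : ℕ →₀ ℤ :=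
  x + Finsupp.single i (-(s * n)) + Finsupp.single (i + 1) s

lemma carry_sigma (n : ℕ) (x : ℕ →₀ ℤ) (i : ℕ) (s : ℤ) : sigmaD n (carry n x i s) = sigmaD n x := by
  unfold carry
  rw [sigma_add, sigma_add, sigma_single, sigma_single]; ring

lemma carry_apply (n : ℕ) (x : ℕ →₀ ℤ) (i : ℕ) (s : ℤ) (j : ℕ) : carry n x i s j =
    if j = i then x i - s * n else if j = i + 1 then x (i + 1) + s else x j := by
  unfold carry
  rw [Finsupp.add_apply, Finsupp.add_apply, Finsupp.single_apply, Finsupp.single_apply]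
  grind

lemma carry_l1 (n : ℕ) (x : ℕ →₀ ℤ) (i : ℕ) (s : ℤ) :
    (l1D (carry n x i s) : ℤ) = l1D x - |x i| - |x (i+1)| + |x i - s * n| + |x (i+1) + s| := by
  unfold carry
  have h1 := l1_add_single x i (-(s * n))
  have h2 := l1_add_single (x + Finsupp.single i (-(s * n))) (i + 1) s
  rw [Finsupp.add_apply, Finsupp.single_apply, if_neg (by omega), add_zero] at h2
  rw [← sub_eq_add_neg] at h1
  linarith

/-- norm-minimal and abs-lex-minimal -/
def Best (n : ℕ) (y : ℕ →₀ ℤ) : Prop :=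
  (∀ z, sigmaD n z = sigmaD n y → l1D y ≤ l1D z) ∧
  (∀ z, sigmaD n z = sigmaD n y → l1D z = l1D y → absLexLE y z)

lemma exists_best (n : ℕ) (hn : 2 ≤ n) (X : ℕ →₀ ℤ) (K : ℕ) (hX : ∀ i, |X i| ≤ n - 1)
    (hK : kIdx X ≤ K) : ∃ y, sigmaD n y = sigmaD n X ∧ Best n y ∧ kIdx y ≤ K + 1 := by
  obtain ⟨m, ⟨y0, hy0, hm⟩, hmin⟩ : ∃ m, (∃ y, sigmaD n y = sigmaD n X ∧ l1D y = m) ∧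
      ∀ y, sigmaD n y = sigmaD n X → m ≤ l1D y := by
    classical
    have hex : ∃ m, ∃ y, sigmaD n y = sigmaD n X ∧ l1D y = m := ⟨_, X, rfl, rfl⟩
    exact ⟨Nat.find hex, Nat.find_spec hex, fun y hy => Nat.find_min' hex ⟨y, hy, rfl⟩⟩
  have hsupp : ∀ z, sigmaD n z = sigmaD n X → l1D z = m → kIdx z ≤ K + 1 := by
    intro z hz hz'
    by_contra h
    obtain ⟨t, h1, h2, h3, h4⟩ := clip n hn X z K hX hK hz
    have := h4 (by omega)
    have := hmin t h2
    omega
  let P : Set (ℕ →₀ ℤ) := {z | sigmaD n z = sigmaD n X ∧ l1D z = m}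
  let f : (ℕ →₀ ℤ) → Lex (Fin (K + 2) → ℕ) := fun z => toLex fun i => (z i).natAbs
  have hne : (f '' P).Nonempty := ⟨_, y0, ⟨hy0, hm⟩, rfl⟩
  obtain ⟨_, ⟨y, ⟨hy, hym⟩, rfl⟩, hymin⟩ := WellFounded.has_min (wellFounded_lt (α := Lex (Fin (K + 2) → ℕ))) _ hne
  refine ⟨y, hy, ⟨?_, ?_⟩, hsupp y hy hym⟩
  · intro z hz
    rw [hym]; exact hmin z (hz.trans hy)
  · intro z hz hzl
    have hzm := hzl.trans hym
    have hz' := hz.trans hy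
    have hle : f y ≤ f z := not_lt.1 (hymin (f z) ⟨z, ⟨hz', hzm⟩, rfl⟩)
    rcases eq_or_lt_of_le hle with h | h
    · left
      intro i
      by_cases hi : i < K + 2
      · have := congrFun (toLex.injective h) ⟨i, hi⟩
        simp only at this
        rw [Int.abs_eq_natAbs, Int.abs_eq_natAbs, this]
      · rw [above_kIdx y i (by have := hsupp y hy hym; omega), above_kIdx z i (by have := hsupp z hz' hzm; omega)]
    · right
      obtain ⟨i, h1, h2⟩ := h
      refine ⟨i, fun j hj => ?_, ?_⟩
      · have := h1 ⟨j, by omega⟩ hj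
        simp [f] at this
        rw [Int.abs_eq_natAbs, Int.abs_eq_natAbs, this]
      · simp [f] at h2
        rw [Int.abs_eq_natAbs, Int.abs_eq_natAbs]
        exact_mod_cast h2

lemma best_digits (n : ℕ) (hn : 2 ≤ n) (y : ℕ →₀ ℤ) (hy : Best n y) (i : ℕ) :
    |y i| ≤ ((n / 2 : ℕ) : ℤ) := by
  by_contra h
  obtain ⟨s, hs, hs'⟩ : ∃ s : ℤ, |s| = 1 ∧ |y i - s * n| < |y i| := by
    rcases le_total 0 (y i) with h0 | h0
    · exact ⟨1, by simp, by grind⟩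
    · exact ⟨-1, by simp, by grind⟩
  have hl := carry_l1 n y i s
  have h2 := abs_add_le (y (i+1)) s
  have h3 := hy.1 _ (carry_sigma n y i s)
  have h4 := hy.2 _ (carry_sigma n y i s) (by omega)
  rcases h4 with h4 | ⟨j, h4, h5⟩
  · have := h4 i
    rw [carry_apply, if_pos rfl] at this
    omega
  · rcases lt_trichotomy j i with hj | hj | hj
    · rw [carry_apply, if_neg (by omega), if_neg (by omega)] at h5
      omega
    · subst hj
      rw [carry_apply, if_pos rfl] at h5
      omega
    · have := h4 i hj
      rw [carry_apply, if_pos rfl] at this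
      omega

lemma sigma_low (n : ℕ) (D : ℕ →₀ ℤ) (i : ℕ) (h : ∀ j < i, D j = 0) :
    ∃ r : ℤ, sigmaD n D = (n:ℤ) ^ i * (D i + n * D (i+1) + n * n * r) := by
  rw [sigma_range n D (i + 1 + 1 + kIdx D) (by omega), Finset.sum_range_add, Finset.sum_range_succ,
    Finset.sum_range_succ, Finset.sum_eq_zero (fun j hj => by rw [h j (Finset.mem_range.1 hj)]; simp)]
  refine ⟨∑ x ∈ Finset.range (kIdx D), D (i + 1 + 1 + x) * (n:ℤ) ^ x, ?_⟩
  have : ∑ x ∈ Finset.range (kIdx D), D (i + 1 + 1 + x) * (n:ℤ) ^ (i + 1 + 1 + x) =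
      (n:ℤ) ^ i * (n * n * ∑ x ∈ Finset.range (kIdx D), D (i + 1 + 1 + x) * (n:ℤ) ^ x) := by
    rw [Finset.mul_sum, Finset.mul_sum]
    exact Finset.sum_congr rfl fun x _ => by ring
  rw [this]; ring

lemma absLex_antisymm (x z : ℕ →₀ ℤ) (h1 : absLexLE x z) (h2 : absLexLE z x) (i : ℕ) :
    |x i| = |z i| := by
  rcases h1 with h1 | ⟨a, h1, h1'⟩
  · exact h1 i
  · rcases h2 with h2 | ⟨b, h2, h2'⟩
    · exact (h2 i).symm
    · rcases lt_trichotomy a b with h | h | h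
      · have := h2 a h; omega
      · subst h; omega
      · have := h1 b h; omega

lemma uniq (n : ℕ) (hn : 2 ≤ n) (x z : ℕ →₀ ℤ) (hs : sigmaD n x = sigmaD n z)
    (hk : kIdx x = kIdx z) (hx : ∀ i < kIdx x, |x i| ≤ ((n / 2 : ℕ) : ℤ))
    (hz : ∀ i < kIdx z, |z i| ≤ ((n / 2 : ℕ) : ℤ))
    (hev : Even n → ∀ i, |x i| = |z i|) : x = z := by
  classical
  by_contra hne
  have hex : ∃ i, x i ≠ z i := by
    by_contra h
    push Not at h
    exact hne (Finsupp.ext h)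
  obtain ⟨i, hi, hlt⟩ : ∃ i, x i ≠ z i ∧ ∀ j < i, x j = z j :=
    ⟨Nat.find hex, Nat.find_spec hex, fun j hj => by
      have := Nat.find_min hex hj; push Not at this; exact this⟩
  have hn0 : (n:ℤ) ≠ 0 := by positivity
  obtain ⟨r, hr⟩ := sigma_low n (x - z) i (fun j hj => by simp [hlt j hj])
  rw [sigma_sub, hs, sub_self] at hr
  have hr' := (mul_eq_zero.1 hr.symm).resolve_left (pow_ne_zero _ hn0)
  simp only [Finsupp.sub_apply] at hr'
  have hik : i ≤ kIdx x := by
    by_contra h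
    exact hi (by rw [above_kIdx x i (by omega), above_kIdx z i (by omega)])
  rcases eq_or_lt_of_le hik with e | e
  · have hD : x - z = Finsupp.single i (x i - z i) := by
      ext j
      rw [Finsupp.single_apply, Finsupp.sub_apply]
      split_ifs with h
      · rw [h]
      · rcases lt_or_gt_of_ne h with h | h
        · rw [above_kIdx x j (by omega), above_kIdx z j (by omega)]; rfl
        · rw [hlt j h]; simp
    have h1 := sigma_sub n x z
    rw [hD, sigma_single, hs, sub_self] at h1
    have := (mul_eq_zero.1 h1).resolve_right (pow_ne_zero _ hn0)
    omega
  · have a := hx i e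
    have b := hz i (by omega)
    obtain ⟨q, hq⟩ : (n:ℤ) ∣ x i - z i := ⟨-(x (i+1) - z (i+1)) - n * r, by linarith⟩
    have hq' : q + (x (i+1) - z (i+1)) + n * r = 0 := by
      have : (n:ℤ) * (q + (x (i+1) - z (i+1)) + n * r) = 0 := by rw [hq] at hr'; linarith
      exact (mul_eq_zero.1 this).resolve_left hn0
    have hq0 : q ≠ 0 := by rintro rfl; apply hi; linarith
    have hqa : n * |q| ≤ 2 * ((n / 2 : ℕ) : ℤ) := by
      have : |x i - z i| = n * |q| := by rw [hq, abs_mul, Nat.abs_cast]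
      grind
    have h1 : 1 ≤ |q| := Int.one_le_abs hq0
    have h2 : (n:ℤ) * 1 ≤ n * |q| := by gcongr
    have hnev : n % 2 = 0 := by omega
    have h3 : |q| = 1 := by
      have : (n:ℤ) * |q| ≤ n * 1 := by omega
      have := le_of_mul_le_mul_left this (by positivity)
      omega
    have hab := hev (Nat.even_iff.2 hnev) (i + 1)
    obtain ⟨m, hm⟩ := Nat.even_iff.2 hnev
    have : (n:ℤ) * r = 2 * (m * r) := by rw [hm]; push_cast; ring
    rw [this] at hq'
    generalize (m:ℤ) * r = g at *
    rcases abs_eq_abs.1 hab with h5 | h5 <;> rcases (abs_eq zero_le_one).1 h3 with h6 | h6 <;> omega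

lemma mem_T1 (n : ℕ) (y : ℕ →₀ ℤ) (u w : ℕ) (h0 : y ≠ 0) (hw : kIdx y < w)
    (hd : ∀ i, |y i| ≤ ((n / 2 : ℕ) : ℤ))
    (h1 : ∀ z, sigmaD n z = sigmaD n y → l1D y ≤ l1D z)
    (h2 : Even n → ∀ z, sigmaD n z = sigmaD n y → l1D z = l1D y → absLexLE y z) :
    (u, w, y) ∈ T1set n := by
  refine ⟨⟨h0, ⟨rfl, fun i _ => hd i, fun _ => hd _, fun h => ?_⟩, ?_, ?_⟩, hw⟩
  · simp only at h; omega
  · intro z hz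
    have := h1 z hz
    simp only [etaLen_eq]
    omega
  · intro he z hz hl
    have := h1 z hz
    simp only [etaLen_eq] at hl
    exact h2 he z hz (by omega)

lemma caseA (n : ℕ) (hn : 2 ≤ n) (u w : ℕ) (x : ℕ →₀ ℤ) (hT : (u, w, x) ∈ Tset n)
    (hk : kIdx x < max u w) :
    (∀ i, |x i| ≤ ((n / 2 : ℕ) : ℤ)) ∧
    (∀ z, sigmaD n z = sigmaD n x → l1D x ≤ l1D z) ∧
    (Even n → ∀ z, sigmaD n z = sigmaD n x → l1D z = l1D x → absLexLE x z) := by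
  obtain ⟨h0, ⟨-, hb1, hb2, -⟩, hm1, hm2⟩ := hT
  simp only at h0 hb1 hb2 hm1 hm2
  have hd : ∀ i, |x i| ≤ ((n / 2 : ℕ) : ℤ) := by
    intro i
    rcases lt_trichotomy i (kIdx x) with h | h | h
    · exact hb1 i h
    · rw [h]; exact hb2 hk
    · rw [above_kIdx x i h, abs_zero]; omega
  have hd' : ∀ i, |x i| ≤ n - 1 := fun i => (hd i).trans (by omega)
  have hmin : ∀ z, sigmaD n z = sigmaD n x → l1D x ≤ l1D z := by
    intro z hz
    obtain ⟨t, h1, h2, h3, h4⟩ := clip n hn x z _ hd' le_rfl hz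
    have := hm1 t h2
    simp only [etaLen_eq] at this
    omega
  refine ⟨hd, hmin, fun he z hz hl => hm2 he z hz ?_⟩
  obtain ⟨t, h1, h2, h3, h4⟩ := clip n hn x z _ hd' le_rfl hz
  have := hmin t h2
  simp only [etaLen_eq]
  have : ¬ (kIdx x + 1 < kIdx z) := fun h => by have := h4 h; omega
  omega

lemma sigma_zero (n : ℕ) : sigmaD n 0 = 0 := by simp [sigmaD]

lemma T_sigma_ne (n : ℕ) (u w : ℕ) (x : ℕ →₀ ℤ) (hT : (u, w, x) ∈ Tset n) : sigmaD n x ≠ 0 := by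
  intro h
  obtain ⟨h0, -, hm1, -⟩ := hT
  simp only at h0 hm1
  have := hm1 0 (by rw [sigma_zero, h])
  simp only [etaLen_eq] at this
  have e1 : l1D 0 = 0 := by simp [l1D]
  have e2 : kIdx 0 = 0 := by simp [kIdx]
  have e3 : l1D x = 0 := by omega
  apply h0
  have := l1_range x (kIdx x + 1) (by omega)
  rw [e3, Nat.cast_zero, eq_comm, Finset.sum_eq_zero_iff_of_nonneg (fun _ _ => abs_nonneg _)] at this
  ext i
  by_cases hi : i < kIdx x + 1
  · exact abs_eq_zero.1 (this i (Finset.mem_range.2 hi))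
  · exact above_kIdx x i (by omega)

lemma T_best (n : ℕ) (hn : 2 ≤ n) (u w : ℕ) (x : ℕ →₀ ℤ) (hT : (u, w, x) ∈ Tset n) :
    ∃ y, sigmaD n y = sigmaD n x ∧ Best n y ∧ kIdx y ≤ kIdx x + 2 ∧ kIdx x ≤ kIdx y + 1 := by
  suffices h : ∃ y, sigmaD n y = sigmaD n x ∧ Best n y ∧ kIdx y ≤ kIdx x + 2 by
    obtain ⟨y, h1, h2, h3⟩ := h
    refine ⟨y, h1, h2, h3, ?_⟩
    by_contra hc
    obtain ⟨t, a1, a2, a3, a4⟩ := clip n hn y x _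
      (fun i => (best_digits n hn y h2 i).trans (by omega)) le_rfl h1.symm
    have := a4 (by omega)
    have := hT.2.2.1 t (a2.trans h1)
    simp only [etaLen_eq] at this
    omega
  obtain ⟨h0, ⟨-, hb1, hb2, hb3⟩, -⟩ := hT
  simp only at h0 hb1 hb2 hb3
  have htop : |x (kIdx x)| ≤ ((n / 2 : ℕ) : ℤ) + if n = 2 then 2 else 1 := by
    rcases lt_or_ge (kIdx x) (max u w) with h | h
    · have := hb2 h
      split_ifs <;> omega
    · exact hb3 h
  by_cases h2 : n = 2
  · subst h2
    simp only [if_true] at htop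
    have htop : |x (kIdx x)| ≤ 3 := by omega
    obtain ⟨s, hs, hs'⟩ : ∃ s : ℤ, |s| ≤ 1 ∧ |x (kIdx x) - s * (2:ℕ)| ≤ 1 := by
      rcases lt_trichotomy (x (kIdx x)) 0 with h | h | h
      · exact ⟨-1, by simp, by rw [abs_le] at *; constructor <;> push_cast <;> omega⟩
      · exact ⟨0, by simp, by simp [h]⟩
      · exact ⟨1, by simp, by rw [abs_le] at *; constructor <;> push_cast <;> omega⟩
    obtain ⟨y, a1, a2, a3⟩ := exists_best 2 hn (carry 2 x (kIdx x) s) (kIdx x + 1) (by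
        intro i
        rw [carry_apply]
        push_cast at *
        split_ifs with b1 b2
        · omega
        · rw [above_kIdx x (kIdx x + 1) (by omega), zero_add]; omega
        · rcases lt_or_gt_of_ne b1 with h | h
          · have := hb1 i h; omega
          · rw [above_kIdx x i h]; simp)
      ((kIdx_le _ _).2 fun i hi => by
        rw [carry_apply, if_neg (by omega), if_neg (by omega)]
        exact above_kIdx x i (by omega))
    exact ⟨y, by rw [a1, carry_sigma], a2, by omega⟩
  · rw [if_neg h2] at htop
    obtain ⟨y, a1, a2, a3⟩ := exists_best n hn x (kIdx x) (by
        intro i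
        rcases lt_trichotomy i (kIdx x) with h | h | h
        · have := hb1 i h; omega
        · rw [h]; omega
        · rw [above_kIdx x i h]; simp; omega) le_rfl
    exact ⟨y, a1, a2, by omega⟩

lemma uniqB (n : ℕ) (hn : 2 ≤ n) (u w u2 w2 : ℕ) (x x2 : ℕ →₀ ℤ) (hT : (u, w, x) ∈ Tset n)
    (hT2 : (u2, w2, x2) ∈ Tset n) (hs : sigmaD n x = sigmaD n x2) (hk : kIdx x = kIdx x2) :
    max u w ≤ kIdx x → max u2 w2 ≤ kIdx x2 → x = x2 := by
  intro _ _
  obtain ⟨h0, ⟨-, hb1, -, -⟩, hm1, hm2⟩ := hT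
  obtain ⟨h0', ⟨-, hb1', -, -⟩, hm1', hm2'⟩ := hT2
  simp only at hb1 hb1' hm1 hm2 hm1' hm2'
  have e1 := hm1 x2 hs.symm
  have e2 := hm1' x hs
  simp only [etaLen_eq] at e1 e2
  refine uniq n hn x x2 hs hk hb1 hb1' fun he i => absLex_antisymm _ _ ?_ ?_ i
  · exact hm2 he x2 hs.symm (by simp only [etaLen_eq]; omega)
  · exact hm2' he x hs (by simp only [etaLen_eq]; omega)

/-- There is a map `Φ` from minimal triples to strict shape 1 minimal triples which
increases the geodesic length by exactly `3` and has degree at most `20`. -/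
theorem shape_map_exists (n : ℕ) (hn : 2 ≤ n) :
    ∃ Φ : ℕ × ℕ × (ℕ →₀ ℤ) → ℕ × ℕ × (ℕ →₀ ℤ),
      (∀ p ∈ Tset n, Φ p ∈ T1set n ∧
        etaLen (Φ p).1 (Φ p).2.1 (Φ p).2.2 = etaLen p.1 p.2.1 p.2.2 + 3) ∧
      (∀ q ∈ T1set n, {p ∈ Tset n | Φ p = q}.encard ≤ 20) := by
  classical
  have hY : ∀ p : ℕ × ℕ × (ℕ →₀ ℤ), ∃ y, p ∈ Tset n → sigmaD n y = sigmaD n p.2.2 ∧ Best n y ∧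
      kIdx y ≤ kIdx p.2.2 + 2 ∧ kIdx p.2.2 ≤ kIdx y + 1 := by
    rintro ⟨u, w, x⟩
    by_cases h : (u, w, x) ∈ Tset n
    · obtain ⟨y, hy⟩ := T_best n hn u w x h
      exact ⟨y, fun _ => hy⟩
    · exact ⟨0, fun h' => absurd h' h⟩
  choose Y hY using hY
  obtain ⟨Φ, hA, hB⟩ : ∃ Φ : ℕ × ℕ × (ℕ →₀ ℤ) → ℕ × ℕ × (ℕ →₀ ℤ),
      (∀ u w x, kIdx x < max u w → Φ (u, w, x) = (min u w, max u w + 3, x)) ∧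
      (∀ u w x, ¬ kIdx x < max u w → Φ (u, w, x) = (min u w,
        kIdx x + 3 + (kIdx x - max u w) + (l1D x - l1D (Y (u, w, x))), Y (u, w, x))) := by
    refine ⟨fun p => if kIdx p.2.2 < max p.1 p.2.1 then (min p.1 p.2.1, max p.1 p.2.1 + 3, p.2.2)
      else (min p.1 p.2.1, kIdx p.2.2 + 3 + (kIdx p.2.2 - max p.1 p.2.1) + (l1D p.2.2 - l1D (Y p)), Y p),
      fun u w x h => if_pos h, fun u w x h => if_neg h⟩
  refine ⟨Φ, ?_, ?_⟩
  · rintro ⟨u, w, x⟩ hT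
    by_cases hk : kIdx x < max u w
    · rw [hA u w x hk]
      obtain ⟨h1, h2, h3⟩ := caseA n hn u w x hT hk
      refine ⟨mem_T1 n x _ _ hT.1 (by omega) h1 h2 h3, ?_⟩
      simp only [etaLen_eq]
      omega
    · rw [hB u w x hk]
      obtain ⟨a1, a2, a3, a4⟩ := hY _ hT
      simp only at a1 a3 a4
      have hne : Y (u, w, x) ≠ 0 := by
        intro h
        rw [h, sigma_zero] at a1
        exact T_sigma_ne n u w x hT a1.symm
      have hl := a2.1 x a1.symm
      refine ⟨mem_T1 n _ _ _ hne (by omega) (best_digits n hn _ a2) a2.1 (fun _ => a2.2), ?_⟩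
      simp only [etaLen_eq]
      omega
  · rintro ⟨u', w', y⟩ -
    let c : ℕ × ℕ × (ℕ →₀ ℤ) → Bool × Bool × ℕ :=
      fun p => (decide (p.1 ≤ p.2.1), decide (kIdx p.2.2 < max p.1 p.2.1), kIdx p.2.2)
    let F : Finset (Bool × Bool × ℕ) :=
      Finset.univ ×ˢ Finset.univ ×ˢ Finset.Icc (kIdx y - 2) (kIdx y + 1)
    have hF : (F : Set (Bool × Bool × ℕ)).encard ≤ 20 := by
      rw [Set.encard_coe_eq_coe_finsetCard]
      have : F.card ≤ 20 := by
        simp only [F, Finset.card_product, Finset.card_univ, Fintype.card_bool, Nat.card_Icc]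
        omega
      exact_mod_cast this
    refine le_trans (Set.encard_le_encard_of_injOn (f := c) (t := F) ?_ ?_) hF
    · rintro ⟨u, w, x⟩ ⟨hT, hq⟩
      simp only [F, c, Finset.coe_product, Set.mem_prod, Finset.coe_univ, Set.mem_univ, true_and,
        Finset.coe_Icc, Set.mem_Icc]
      by_cases hk : kIdx x < max u w
      · rw [hA u w x hk] at hq
        simp only [Prod.mk.injEq] at hq
        rw [hq.2.2]; omega
      · rw [hB u w x hk] at hq
        simp only [Prod.mk.injEq] at hq
        obtain ⟨a1, a2, a3, a4⟩ := hY _ hT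
        simp only [hq.2.2] at a3 a4
        omega
    · rintro ⟨u, w, x⟩ ⟨hT, hq⟩ ⟨u2, w2, x2⟩ ⟨hT2, hq2⟩ hc
      simp only [c, Prod.mk.injEq, decide_eq_decide] at hc
      obtain ⟨c1, c2, c3⟩ := hc
      by_cases hk : kIdx x < max u w
      · have hk2 := c2.1 hk
        rw [hA u w x hk] at hq
        rw [hA u2 w2 x2 hk2] at hq2
        simp only [Prod.mk.injEq] at hq hq2 ⊢
        refine ⟨by omega, by omega, by rw [hq.2.2, hq2.2.2]⟩
      · have hk2 : ¬ kIdx x2 < max u2 w2 := fun h => hk (c2.2 h)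
        rw [hB u w x hk] at hq
        rw [hB u2 w2 x2 hk2] at hq2
        simp only [Prod.mk.injEq] at hq hq2 ⊢
        have s1 := (hY _ hT).1
        have s2 := (hY _ hT2).1
        rw [hq.2.2] at s1 hq
        rw [hq2.2.2] at s2 hq2
        have e := uniqB n hn u w u2 w2 x x2 hT hT2 (s1.symm.trans s2) c3 (by omega) (by omega)
        subst e
        refine ⟨by omega, by omega, rfl⟩
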